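/- In the abstract robust setting, assume additionally that D_y > 0 and E_st, osc_st ≥ 0 satisfy E_st ≤ D_y (‖ŷ − y_T‖_R + osc_st). Then the state estimator is efficient: E_st² ≤ 3 D_y² ((9/κ) ‖ū − u_T‖_H² + ‖ȳ − y_T‖_R² + osc_st²). -/

import Mathlib

open MeasureTheory
open scoped InnerProductSpace

/-- In the abstract robust setting, if `D_y > 0` and `E_st, osc_st ≥ 0` satisfy
`E_st ≤ D_y (‖ŷ − y_T‖_R + osc_st)`, then the state estimator is efficient:
`E_st² ≤ 3 D_y² ((9/κ) ‖ū − u_T‖² + ‖ȳ − y_T‖_R² + osc_st²)`. -/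
theorem robust_state_estimator_efficiency
    {Ω : Type*} [MeasurableSpace Ω] (μ : Measure Ω) [IsFiniteMeasure μ]
    (a b : ℝ) (hab : a < b)
    (Pi : Lp ℝ 2 μ → Lp ℝ 2 μ)
    (hPi : ∀ w : Lp ℝ 2 μ, (⇑(Pi w)) =ᵐ[μ] fun x => min b (max a (w x)))
    (κ ϑ : ℝ) (hκ : 0 < κ) (hϑ : 0 < ϑ)
    {V : Type*} [AddCommGroup V] [Module ℝ V]
    (NOm NR : V → ℝ)
    (hNOm_add : ∀ v w : V, NOm (v + w) ≤ NOm v + NOm w)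
    (hNOm_smul : ∀ (c : ℝ) (v : V), NOm (c • v) = |c| * NOm v)
    (hNOm_eq_zero : ∀ v : V, NOm v = 0 ↔ v = 0)
    (hNR_add : ∀ v w : V, NR (v + w) ≤ NR v + NR w)
    (hNR_smul : ∀ (c : ℝ) (v : V), NR (c • v) = |c| * NR v)
    (hNR_eq_zero : ∀ v : V, NR v = 0 ↔ v = 0)
    (hOmR : ∀ v : V, NOm v ≤ NR v)
    (ι : V →ₗ[ℝ] Lp ℝ 2 μ)
    (hι : ∀ v : V, ‖ι v‖ ≤ (Real.sqrt κ)⁻¹ * NOm v)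
    (B Bstar : V →ₗ[ℝ] V →ₗ[ℝ] ℝ)
    (hBstar : ∀ w v : V, Bstar w v = B v w)
    (hinfsupB : ∀ w : V, ∀ c : ℝ, (∀ v : V, B w v ≤ c * NOm v) → NR w ≤ 3 * c)
    (hinfsupBstar : ∀ w : V, ∀ c : ℝ, (∀ v : V, Bstar w v ≤ c * NOm v) → NR w ≤ 3 * c)
    (f yΩ : Lp ℝ 2 μ)
    (ybar pbar : V) (ubar : Lp ℝ 2 μ)
    (hubar_mem : ∀ᵐ x ∂μ, a ≤ ubar x ∧ ubar x ≤ b)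
    (hstate : ∀ v : V, B ybar v = ⟪f + ubar, ι v⟫_ℝ)
    (hadjoint : ∀ w : V, Bstar pbar w = ⟪ι ybar - yΩ, ι w⟫_ℝ)
    (hVI : ∀ u : Lp ℝ 2 μ, (∀ᵐ x ∂μ, a ≤ u x ∧ u x ≤ b) →
        0 ≤ ⟪ι pbar + ϑ • ubar, u - ubar⟫_ℝ)
    (yT pT : V) (uT : Lp ℝ 2 μ)
    (huT_mem : ∀ᵐ x ∂μ, a ≤ uT x ∧ uT x ≤ b)
    (utilde : Lp ℝ 2 μ) (hutilde : utilde = Pi (-ϑ⁻¹ • ι pT))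
    (ηct : ℝ) (hηct : ηct = ‖uT - utilde‖)
    (yhat phat ytilde ptilde : V)
    (hyhat : ∀ v : V, B yhat v = ⟪f + uT, ι v⟫_ℝ)
    (hphat : ∀ w : V, Bstar phat w = ⟪ι yT - yΩ, ι w⟫_ℝ)
    (hytilde : ∀ v : V, B ytilde v = ⟪f + utilde, ι v⟫_ℝ)
    (hptilde : ∀ w : V, Bstar ptilde w = ⟪ι ytilde - yΩ, ι w⟫_ℝ)
    (Dy Est oscst : ℝ) (hDy : 0 < Dy) (hEst0 : 0 ≤ Est) (hosc0 : 0 ≤ oscst)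
    (hEst : Est ≤ Dy * (NR (yhat - yT) + oscst)) :
    Est ^ 2 ≤ 3 * Dy ^ 2 * (9 / κ * ‖ubar - uT‖ ^ 2 + NR (ybar - yT) ^ 2 + oscst ^ 2) := by
  have hdiff : NR (yhat - ybar) ≤ 3 * (‖ubar - uT‖ * (Real.sqrt κ)⁻¹) := by
    refine hinfsupB _ _ fun v => ?_
    have hB : B (yhat - ybar) v = ⟪uT - ubar, ι v⟫_ℝ := by
      rw [map_sub, LinearMap.sub_apply, hyhat, hstate, ← inner_sub_left, add_sub_add_left_eq_sub]
    calc B (yhat - ybar) v = ⟪uT - ubar, ι v⟫_ℝ := hB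
      _ ≤ ‖uT - ubar‖ * ‖ι v‖ := real_inner_le_norm _ _
      _ ≤ ‖uT - ubar‖ * ((Real.sqrt κ)⁻¹ * NOm v) := by gcongr; exact hι v
      _ = ‖ubar - uT‖ * (Real.sqrt κ)⁻¹ * NOm v := by rw [norm_sub_rev, mul_assoc]
  have htri : NR (yhat - yT) ≤ NR (yhat - ybar) + NR (ybar - yT) := by
    simpa using hNR_add (yhat - ybar) (ybar - yT)
  set s := 3 * (‖ubar - uT‖ * (Real.sqrt κ)⁻¹) with hs
  have hs_sq : s ^ 2 = 9 / κ * ‖ubar - uT‖ ^ 2 := by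
    rw [hs, mul_pow, mul_pow, inv_pow, Real.sq_sqrt hκ.le]
    ring
  have hEst_le : Est ≤ Dy * (s + NR (ybar - yT) + oscst) :=
    hEst.trans (mul_le_mul_of_nonneg_left (by linarith) hDy.le)
  have hsum_sq : (s + NR (ybar - yT) + oscst) ^ 2
      ≤ 3 * (s ^ 2 + NR (ybar - yT) ^ 2 + oscst ^ 2) := by
    nlinarith [sq_nonneg (s - NR (ybar - yT)), sq_nonneg (s - oscst),
      sq_nonneg (NR (ybar - yT) - oscst)]
  rw [← hs_sq]
  calc Est ^ 2 ≤ (Dy * (s + NR (ybar - yT) + oscst)) ^ 2 := pow_le_pow_left₀ hEst0 hEst_le 2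
    _ = Dy ^ 2 * (s + NR (ybar - yT) + oscst) ^ 2 := mul_pow _ _ _
    _ ≤ Dy ^ 2 * (3 * (s ^ 2 + NR (ybar - yT) ^ 2 + oscst ^ 2)) := by gcongr
    _ = 3 * Dy ^ 2 * (s ^ 2 + NR (ybar - yT) ^ 2 + oscst ^ 2) := by ring
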